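/- For every type S with free type variables among ᾱ, every type variable c, every type T, every sequence of types T̄ of the same length as ᾱ, and every sequence of reducibility candidates R̄ with R_i ∈ RC(T_i), the parametric reducibility candidates satisfy RED_{S[c:=T]}(ᾱ ↦ R̄) = RED_S(ᾱ, c ↦ R̄, RED_T(ᾱ ↦ R̄)). -/

import Mathlib

/-!
Language `λFv`: explicitly typed System F extended with the abortive control
operator `callcc` and a `throw` construct, in de Bruijn representation
(separate de Bruijn indices for term variables, continuation variables and
type variables).
-/

namespace LambdaFv

/-- Types of System F: type variables (de Bruijn), arrow types, universal types. -/
inductive Ty : Type where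
  | var : Nat → Ty
  | arrow : Ty → Ty → Ty
  | all : Ty → Ty

/-- Lifting of a renaming under a binder. -/
def liftRen (ρ : Nat → Nat) : Nat → Nat
  | 0 => 0
  | n+1 => ρ n + 1

/-- Renaming of type variables in a type. -/
def renTy (ρ : Nat → Nat) : Ty → Ty
  | .var n => .var (ρ n)
  | .arrow a b => .arrow (renTy ρ a) (renTy ρ b)
  | .all a => .all (renTy (liftRen ρ) a)

/-- Lifting of a type substitution under a type binder. -/
def liftTySub (σ : Nat → Ty) : Nat → Ty
  | 0 => .var 0
  | n+1 => renTy Nat.succ (σ n)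

/-- Simultaneous substitution of types for type variables in a type. -/
def subTy (σ : Nat → Ty) : Ty → Ty
  | .var n => σ n
  | .arrow a b => .arrow (subTy σ a) (subTy σ b)
  | .all a => .all (subTy (liftTySub σ) a)

/-- `subTy0 U S` is `S[α₀ := U]` (instantiation of the type variable 0). -/
def subTy0 (U : Ty) (S : Ty) : Ty :=
  subTy (fun n => match n with | 0 => U | n+1 => .var n) S

/-- `subTyList Ts S` is `S[ᾱ := Ts]`: simultaneous substitution of the types
`Ts` for the free type variables of `S`. -/
def subTyList (Ts : List Ty) (S : Ty) : Ty :=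
  subTy (fun n => Ts.getD n (.var n)) S

/-- `ScopedTy p S`: all free type variables of `S` are among `α₀,…,α_{p-1}`. -/
inductive ScopedTy : Nat → Ty → Prop where
  | var : ∀ {p n}, n < p → ScopedTy p (.var n)
  | arrow : ∀ {p a b}, ScopedTy p a → ScopedTy p b → ScopedTy p (.arrow a b)
  | all : ∀ {p a}, ScopedTy (p+1) a → ScopedTy p (.all a)

/-- A closed type: no free type variables. -/
def ClosedTy (S : Ty) : Prop := ScopedTy 0 S

mutual
/-- Terms of `λFv`:
variables, `λx:S.t`, application, `Λα.t`, type application, `K k.t` (callcc),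
`k ← t` (throw to a continuation variable), `⌈E⌉ ← t` (throw to a reified context). -/
inductive Tm : Type where
  | var : Nat → Tm
  | lam : Ty → Tm → Tm
  | app : Tm → Tm → Tm
  | tlam : Tm → Tm
  | tapp : Tm → Ty → Tm
  | callcc : Tm → Tm
  | throwVar : Nat → Tm → Tm
  | throwCtx : Ctx → Tm → Tm

/-- Call-by-value evaluation contexts, represented inside-out:
`[]`, `(λx:S.t)·E`, `E t`, `E S`, `⌈E₀⌉ ← E`. -/
inductive Ctx : Type where
  | hole : Ctx
  | lamApp : Ty → Tm → Ctx → Ctx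
  | app : Ctx → Tm → Ctx
  | tapp : Ctx → Ty → Ctx
  | throw : Ctx → Ctx → Ctx
end

/-- Plugging a term in a context (contexts are represented inside-out). -/
def plug : Tm → Ctx → Tm
  | t, .hole => t
  | t, .lamApp S b E => plug (.app (.lam S b) t) E
  | t, .app E u => plug (.app t u) E
  | t, .tapp E S => plug (.tapp t S) E
  | t, .throw E0 E => plug (.throwCtx E0 t) E

/-- Values: λ-abstractions and Λ-abstractions. -/
inductive IsValue : Tm → Prop where
  | lam : ∀ {S t}, IsValue (.lam S t)
  | tlam : ∀ {t}, IsValue (.tlam t)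

/-- Plain terms: terms with no subterm of the form `⌈E⌉ ← t`. -/
inductive Plain : Tm → Prop where
  | var : ∀ {n}, Plain (.var n)
  | lam : ∀ {S t}, Plain t → Plain (.lam S t)
  | app : ∀ {a b}, Plain a → Plain b → Plain (.app a b)
  | tlam : ∀ {t}, Plain t → Plain (.tlam t)
  | tapp : ∀ {t S}, Plain t → Plain (.tapp t S)
  | callcc : ∀ {t}, Plain t → Plain (.callcc t)
  | throwVar : ∀ {k t}, Plain t → Plain (.throwVar k t)

mutual
/-- `ScTm n m p t`: the free term variables of `t` are `< n`, its free
continuation variables are `< m` and its free type variables are `< p`. -/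
inductive ScTm : Nat → Nat → Nat → Tm → Prop where
  | var : ∀ {n m p x}, x < n → ScTm n m p (.var x)
  | lam : ∀ {n m p S t}, ScopedTy p S → ScTm (n+1) m p t → ScTm n m p (.lam S t)
  | app : ∀ {n m p a b}, ScTm n m p a → ScTm n m p b → ScTm n m p (.app a b)
  | tlam : ∀ {n m p t}, ScTm n m (p+1) t → ScTm n m p (.tlam t)
  | tapp : ∀ {n m p t S}, ScTm n m p t → ScopedTy p S → ScTm n m p (.tapp t S)
  | callcc : ∀ {n m p t}, ScTm n (m+1) p t → ScTm n m p (.callcc t)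
  | throwVar : ∀ {n m p k t}, k < m → ScTm n m p t → ScTm n m p (.throwVar k t)
  | throwCtx : ∀ {n m p E t}, ScCtx n m p E → ScTm n m p t → ScTm n m p (.throwCtx E t)

/-- Scoping predicate for contexts. -/
inductive ScCtx : Nat → Nat → Nat → Ctx → Prop where
  | hole : ∀ {n m p}, ScCtx n m p .hole
  | lamApp : ∀ {n m p S t E}, ScopedTy p S → ScTm (n+1) m p t → ScCtx n m p E →
      ScCtx n m p (.lamApp S t E)
  | app : ∀ {n m p E t}, ScCtx n m p E → ScTm n m p t → ScCtx n m p (.app E t)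
  | tapp : ∀ {n m p E S}, ScCtx n m p E → ScopedTy p S → ScCtx n m p (.tapp E S)
  | throw : ∀ {n m p E0 E1}, ScCtx n m p E0 → ScCtx n m p E1 → ScCtx n m p (.throw E0 E1)
end

/-- A closed term: no free variables of any kind. -/
def ClosedTm (t : Tm) : Prop := ScTm 0 0 0 t

/-- A closed context: no free variables of any kind. -/
def ClosedCtx (E : Ctx) : Prop := ScCtx 0 0 0 E

mutual
/-- Renaming of the three kinds of variables in terms. -/
def renTm (ρx ρk ρa : Nat → Nat) : Tm → Tm
  | .var n => .var (ρx n)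
  | .lam S t => .lam (renTy ρa S) (renTm (liftRen ρx) ρk ρa t)
  | .app a b => .app (renTm ρx ρk ρa a) (renTm ρx ρk ρa b)
  | .tlam t => .tlam (renTm ρx ρk (liftRen ρa) t)
  | .tapp t S => .tapp (renTm ρx ρk ρa t) (renTy ρa S)
  | .callcc t => .callcc (renTm ρx (liftRen ρk) ρa t)
  | .throwVar k t => .throwVar (ρk k) (renTm ρx ρk ρa t)
  | .throwCtx E t => .throwCtx (renCtx ρx ρk ρa E) (renTm ρx ρk ρa t)

/-- Renaming of the three kinds of variables in contexts. -/
def renCtx (ρx ρk ρa : Nat → Nat) : Ctx → Ctx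
  | .hole => .hole
  | .lamApp S t E => .lamApp (renTy ρa S) (renTm (liftRen ρx) ρk ρa t) (renCtx ρx ρk ρa E)
  | .app E t => .app (renCtx ρx ρk ρa E) (renTm ρx ρk ρa t)
  | .tapp E S => .tapp (renCtx ρx ρk ρa E) (renTy ρa S)
  | .throw E0 E => .throw (renCtx ρx ρk ρa E0) (renCtx ρx ρk ρa E)
end

/-- An entry of a continuation substitution: either a reified context or a
continuation variable. -/
def mapKEnt (f : Ctx → Ctx) : Ctx ⊕ Nat → Ctx ⊕ Nat
  | .inl E => .inl (f E)
  | .inr n => .inr n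

/-- Lifting of a term substitution under a term binder. -/
def liftSubX (σ : Nat → Tm) : Nat → Tm
  | 0 => .var 0
  | n+1 => renTm Nat.succ id id (σ n)

/-- Shifting of a term substitution under a continuation binder. -/
def shiftSubXk (σ : Nat → Tm) : Nat → Tm := fun n => renTm id Nat.succ id (σ n)

/-- Shifting of a term substitution under a type binder. -/
def shiftSubXa (σ : Nat → Tm) : Nat → Tm := fun n => renTm id id Nat.succ (σ n)

/-- Lifting of a continuation substitution under a continuation binder. -/
def liftSubK (σ : Nat → Ctx ⊕ Nat) : Nat → Ctx ⊕ Nat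
  | 0 => .inr 0
  | n+1 =>
    match σ n with
    | .inl E => .inl (renCtx id Nat.succ id E)
    | .inr m => .inr (m+1)

/-- Shifting of a continuation substitution under a term binder. -/
def shiftSubKx (σ : Nat → Ctx ⊕ Nat) : Nat → Ctx ⊕ Nat :=
  fun n => mapKEnt (renCtx Nat.succ id id) (σ n)

/-- Shifting of a continuation substitution under a type binder. -/
def shiftSubKa (σ : Nat → Ctx ⊕ Nat) : Nat → Ctx ⊕ Nat :=
  fun n => mapKEnt (renCtx id id Nat.succ) (σ n)

mutual
/-- Simultaneous capture-avoiding substitution in terms: `σx` substitutes terms for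
term variables, `σk` substitutes reified contexts for continuation variables,
`σa` substitutes types for type variables. -/
def subTm (σx : Nat → Tm) (σk : Nat → Ctx ⊕ Nat) (σa : Nat → Ty) : Tm → Tm
  | .var n => σx n
  | .lam S t => .lam (subTy σa S) (subTm (liftSubX σx) (shiftSubKx σk) σa t)
  | .app a b => .app (subTm σx σk σa a) (subTm σx σk σa b)
  | .tlam t => .tlam (subTm (shiftSubXa σx) (shiftSubKa σk) (liftTySub σa) t)
  | .tapp t S => .tapp (subTm σx σk σa t) (subTy σa S)
  | .callcc t => .callcc (subTm (shiftSubXk σx) (liftSubK σk) σa t)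
  | .throwVar k t =>
    match σk k with
    | .inl E => .throwCtx E (subTm σx σk σa t)
    | .inr m => .throwVar m (subTm σx σk σa t)
  | .throwCtx E t => .throwCtx (subCtx σx σk σa E) (subTm σx σk σa t)

/-- Simultaneous capture-avoiding substitution in contexts. -/
def subCtx (σx : Nat → Tm) (σk : Nat → Ctx ⊕ Nat) (σa : Nat → Ty) : Ctx → Ctx
  | .hole => .hole
  | .lamApp S t E => .lamApp (subTy σa S) (subTm (liftSubX σx) (shiftSubKx σk) σa t) (subCtx σx σk σa E)
  | .app E t => .app (subCtx σx σk σa E) (subTm σx σk σa t)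
  | .tapp E S => .tapp (subCtx σx σk σa E) (subTy σa S)
  | .throw E0 E => .throw (subCtx σx σk σa E0) (subCtx σx σk σa E)
end

/-- `sub0X v t` is `t[x₀ := v]`. -/
def sub0X (v : Tm) (t : Tm) : Tm :=
  subTm (fun n => match n with | 0 => v | n+1 => .var n) Sum.inr Ty.var t

/-- `sub0A S t` is `t[α₀ := S]`. -/
def sub0A (S : Ty) (t : Tm) : Tm :=
  subTm Tm.var Sum.inr (fun n => match n with | 0 => S | n+1 => .var n) t

/-- `sub0K E t` is `t[k₀ := ⌈E⌉]`. -/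
def sub0K (E : Ctx) (t : Tm) : Tm :=
  subTm Tm.var (fun n => match n with | 0 => .inl E | n+1 => .inr n) Ty.var t

/-- `msub Vs vs Es t` is the simultaneous substitution
`t[ᾱ := Vs][x̄ := vs][k̄ := ⌈Es⌉]`. -/
def msub (Vs : List Ty) (vs : List Tm) (Es : List Ctx) (t : Tm) : Tm :=
  subTm (fun n => vs.getD n (.var n))
        (fun n => match Es[n]? with | some E => .inl E | none => .inr n)
        (fun n => Vs.getD n (.var n)) t

mutual
/-- The type system of Figure 1: typing of terms, `Γ;Δ ⊢ t : S`.
`Γ` assigns types to term variables; `Δ` assigns context types `¬S`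
(represented by their hole type `S`) to continuation variables. -/
inductive HasTy : List Ty → List Ty → Tm → Ty → Prop where
  | var : ∀ {Γ Δ x S}, Γ[x]? = some S → HasTy Γ Δ (.var x) S
  | lam : ∀ {Γ Δ S T t}, HasTy (S::Γ) Δ t T → HasTy Γ Δ (.lam S t) (.arrow S T)
  | app : ∀ {Γ Δ S T t0 t1}, HasTy Γ Δ t0 (.arrow S T) → HasTy Γ Δ t1 S →
      HasTy Γ Δ (.app t0 t1) T
  | tlam : ∀ {Γ Δ t S}, HasTy (Γ.map (renTy Nat.succ)) (Δ.map (renTy Nat.succ)) t S →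
      HasTy Γ Δ (.tlam t) (.all S)
  | tapp : ∀ {Γ Δ t S T}, HasTy Γ Δ t (.all S) → HasTy Γ Δ (.tapp t T) (subTy0 T S)
  | callcc : ∀ {Γ Δ t S}, HasTy Γ (S::Δ) t S → HasTy Γ Δ (.callcc t) S
  | throwVar : ∀ {Γ Δ k t S T}, Δ[k]? = some S → HasTy Γ Δ t S →
      HasTy Γ Δ (.throwVar k t) T
  | throwCtx : ∀ {Γ Δ E t S T}, HasTyCtx Γ Δ E S → HasTy Γ Δ t S →
      HasTy Γ Δ (.throwCtx E t) T

/-- The type system of Figure 1: typing of contexts, `Γ;Δ ⊢ E : ¬S`. -/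
inductive HasTyCtx : List Ty → List Ty → Ctx → Ty → Prop where
  | hole : ∀ {Γ Δ S}, HasTyCtx Γ Δ .hole S
  | lamApp : ∀ {Γ Δ S T t E}, HasTy Γ Δ (.lam S t) (.arrow S T) → HasTyCtx Γ Δ E T →
      HasTyCtx Γ Δ (.lamApp S t E) S
  | app : ∀ {Γ Δ S T t E}, HasTy Γ Δ t S → HasTyCtx Γ Δ E T →
      HasTyCtx Γ Δ (.app E t) (.arrow S T)
  | tapp : ∀ {Γ Δ S T E}, HasTyCtx Γ Δ E (subTy0 T S) → HasTyCtx Γ Δ (.tapp E T) (.all S)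
  | throw : ∀ {Γ Δ S T E0 E1}, HasTyCtx Γ Δ E0 S → HasTyCtx Γ Δ E1 T →
      HasTyCtx Γ Δ (.throw E0 E1) S
end

/-- The call-by-value one-step reduction relation `→v` of `λFv`. -/
inductive Step : Tm → Tm → Prop where
  | beta : ∀ {S t v E}, IsValue v →
      Step (plug (.app (.lam S t) v) E) (plug (sub0X v t) E)
  | betaT : ∀ {t S E},
      Step (plug (.tapp (.tlam t) S) E) (plug (sub0A S t) E)
  | callcc : ∀ {t E},
      Step (plug (.callcc t) E) (plug (sub0K E t) E)
  | throw : ∀ {E0 E1 v}, IsValue v →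
      Step (plug (.throwCtx E0 v) E1) (plug v E0)

/-- Call-by-value evaluation: the reflexive-transitive closure of `→v`. -/
def Steps : Tm → Tm → Prop := Relation.ReflTransGen Step

/-- Redexes of `λFv` under call by value. -/
inductive IsRedex : Tm → Prop where
  | beta : ∀ {S t v}, IsValue v → IsRedex (.app (.lam S t) v)
  | betaT : ∀ {t S}, IsRedex (.tapp (.tlam t) S)
  | callcc : ∀ {t}, IsRedex (.callcc t)
  | throw : ∀ {E v}, IsValue v → IsRedex (.throwCtx E v)

/-- `Norm p`: the program `p` evaluates to a value. -/
def Norm (p : Tm) : Prop := ∃ v, IsValue v ∧ Steps p v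

/-- A reducibility candidate of type `S` is a set of closed values of type `S`. -/
def IsCand (S : Ty) (R : Set Tm) : Prop :=
  ∀ v ∈ R, IsValue v ∧ ClosedTm v ∧ HasTy [] [] v S

/-- `CtxOK R E` is the predicate `R ⊨ E`, i.e. `∀ v ∈ R, norm (E[v])`. -/
def CtxOK (R : Set Tm) (E : Ctx) : Prop := ∀ v ∈ R, Norm (plug v E)

/-- `CtxAdm A R E`: `E` is a closed context of type `¬A` with `R ⊨ E`. -/
def CtxAdm (A : Ty) (R : Set Tm) (E : Ctx) : Prop :=
  ClosedCtx E ∧ HasTyCtx [] [] E A ∧ CtxOK R E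

/-- The parametric reducibility candidate `RED_S(ᾱ ↦ R̄)` (call by value),
defined by induction on `S`.  `Ts` are the types of the candidates `Rs`. -/
def RED : Ty → List Ty → List (Set Tm) → Set Tm
  | .var i, _, Rs => Rs.getD i ∅
  | .arrow S1 S2, Ts, Rs =>
      {v0 | IsValue v0 ∧ ClosedTm v0 ∧ HasTy [] [] v0 (subTyList Ts (.arrow S1 S2)) ∧
        ∀ v1 ∈ RED S1 Ts Rs, ∀ E, CtxAdm (subTyList Ts S2) (RED S2 Ts Rs) E →
          Norm (plug (.app v0 v1) E)}
  | .all S, Ts, Rs =>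
      {v | IsValue v ∧ ClosedTm v ∧ HasTy [] [] v (subTyList Ts (.all S)) ∧
        ∀ (U : Ty) (Rc : Set Tm), IsCand U Rc →
          ∀ E, CtxAdm (subTyList (U::Ts) S) (RED S (U::Ts) (Rc::Rs)) E →
            Norm (plug (.tapp v U) E)}

end LambdaFv
namespace LambdaFv

theorem subTy_congr {p : Nat} {S : Ty} (hS : ScopedTy p S) :
    ∀ {σ τ : Nat → Ty}, (∀ i < p, σ i = τ i) → subTy σ S = subTy τ S := by
  induction hS with
  | var hn => intro σ τ h; exact h _ hn
  | arrow _ _ iha ihb => intro σ τ h; simp only [subTy, iha h, ihb h]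
  | all _ ih =>
    intro σ τ h
    simp only [subTy]
    congr 1
    refine ih ?_
    rintro (_ | i) hi
    · rfl
    · simp only [liftTySub, h i (by omega)]

theorem subTy_renTy (S : Ty) : ∀ (ρ : Nat → Nat) (σ : Nat → Ty),
    subTy σ (renTy ρ S) = subTy (fun i => σ (ρ i)) S := by
  induction S with
  | var n => intro ρ σ; rfl
  | arrow a b iha ihb => intro ρ σ; simp only [subTy, renTy, iha, ihb]
  | all a ih =>
    intro ρ σ
    simp only [subTy, renTy, ih]
    congr 2
    funext i
    cases i <;> rfl

theorem renTy_renTy (S : Ty) : ∀ (ρ ρ' : Nat → Nat),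
    renTy ρ' (renTy ρ S) = renTy (fun i => ρ' (ρ i)) S := by
  induction S with
  | var n => intro ρ ρ'; rfl
  | arrow a b iha ihb => intro ρ ρ'; simp only [renTy, iha, ihb]
  | all a ih =>
    intro ρ ρ'
    simp only [renTy, ih]
    congr 2
    funext i
    cases i <;> rfl

theorem renTy_subTy (S : Ty) : ∀ (σ : Nat → Ty) (ρ : Nat → Nat),
    renTy ρ (subTy σ S) = subTy (fun i => renTy ρ (σ i)) S := by
  induction S with
  | var n => intro σ ρ; rfl
  | arrow a b iha ihb => intro σ ρ; simp only [subTy, renTy, iha, ihb]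
  | all a ih =>
    intro σ ρ
    simp only [subTy, renTy, ih]
    congr 2
    funext i
    cases i with
    | zero => rfl
    | succ i => simp only [liftTySub, renTy_renTy, liftRen]

theorem subTy_subTy (S : Ty) : ∀ (σ τ : Nat → Ty),
    subTy τ (subTy σ S) = subTy (fun i => subTy τ (σ i)) S := by
  induction S with
  | var n => intro σ τ; rfl
  | arrow a b iha ihb => intro σ τ; simp only [subTy, iha, ihb]
  | all a ih =>
    intro σ τ
    simp only [subTy, ih]
    congr 2
    funext i
    cases i with
    | zero => rfl
    | succ i => simp only [liftTySub, subTy_renTy, renTy_subTy]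

theorem ScopedTy.renTy {p : Nat} {S : Ty} (hS : ScopedTy p S) :
    ∀ {q : Nat} {ρ : Nat → Nat}, (∀ i < p, ρ i < q) → ScopedTy q (renTy ρ S) := by
  induction hS with
  | var hn => intro q ρ h; exact .var (h _ hn)
  | arrow _ _ iha ihb => intro q ρ h; exact .arrow (iha h) (ihb h)
  | all _ ih =>
    intro q ρ h
    refine .all (ih ?_)
    rintro (_ | i) hi
    · exact Nat.succ_pos q
    · exact Nat.succ_lt_succ (h i (by omega))

theorem subTyList_renTy {p : Nat} {S : Ty} (hS : ScopedTy p S) {ρ : Nat → Nat} {Ts Ts' : List Ty}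
    (h : ∀ i < p, ∃ U, Ts[ρ i]? = some U ∧ Ts'[i]? = some U) :
    subTyList Ts (renTy ρ S) = subTyList Ts' S := by
  rw [subTyList, subTyList, subTy_renTy]
  refine subTy_congr hS fun i hi => ?_
  obtain ⟨U, hU, hU'⟩ := h i hi
  simp only [List.getD_eq_getElem?_getD, hU, hU', Option.getD_some]

theorem subTyList_subTy {p : Nat} {S : Ty} (hS : ScopedTy p S) {σ : Nat → Ty} {Ts Ts' : List Ty}
    (h : ∀ i < p, Ts'[i]? = some (subTyList Ts (σ i))) :
    subTyList Ts (subTy σ S) = subTyList Ts' S := by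
  rw [subTyList, subTyList, subTy_subTy]
  refine subTy_congr hS fun i hi => ?_
  simp only [List.getD_eq_getElem?_getD, h i hi, Option.getD_some, subTyList]

/-- Renaming lemma for parametric reducibility candidates. -/
theorem RED_renTy {p : Nat} {S : Ty} (hS : ScopedTy p S) :
    ∀ {ρ : Nat → Nat} {Ts Ts' : List Ty} {Rs Rs' : List (Set Tm)},
      (∀ i < p, ∃ U, Ts[ρ i]? = some U ∧ Ts'[i]? = some U) →
      (∀ i < p, Rs.getD (ρ i) ∅ = Rs'.getD i ∅) →
      RED (renTy ρ S) Ts Rs = RED S Ts' Rs' := by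
  induction hS with
  | var hn => intro ρ Ts Ts' Rs Rs' _ hR; exact hR _ hn
  | arrow ha hb iha ihb =>
    intro ρ Ts Ts' Rs Rs' hT hR
    have h := subTyList_renTy (.arrow ha hb) hT
    simp only [renTy] at h
    simp only [RED, renTy, iha hT hR, ihb hT hR, subTyList_renTy hb hT, h]
  | @all p a ha ih =>
    intro ρ Ts Ts' Rs Rs' hT hR
    have h := subTyList_renTy (.all ha) hT
    simp only [renTy] at h
    have hT' : ∀ U : Ty, ∀ i < p + 1,
        ∃ V, (U :: Ts)[liftRen ρ i]? = some V ∧ (U :: Ts')[i]? = some V := by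
      rintro U (_ | i) hi
      · exact ⟨U, rfl, rfl⟩
      · simpa only [liftRen, List.getElem?_cons_succ] using hT i (by omega)
    have hR' : ∀ Rc : Set Tm, ∀ i < p + 1,
        (Rc :: Rs).getD (liftRen ρ i) ∅ = (Rc :: Rs').getD i ∅ := by
      rintro Rc (_ | i) hi
      · rfl
      · simpa only [liftRen, List.getD_cons_succ] using hR i (by omega)
    have hlift := fun U => subTyList_renTy ha (hT' U)
    have hRED := fun U Rc => ih (hT' U) (hR' Rc)
    simp only [RED, renTy, h, hlift, hRED]

theorem exists_getElem?_cons_succ (U : Ty) (Ts : List Ty) :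
    ∀ i < Ts.length, ∃ V, (U :: Ts)[Nat.succ i]? = some V ∧ Ts[i]? = some V :=
  fun i hi => ⟨Ts[i], by simp [hi], by simp [hi]⟩

/-- Simultaneous substitution lemma for parametric reducibility candidates. -/
theorem RED_subTy {p : Nat} {S : Ty} (hS : ScopedTy p S) :
    ∀ {σ : Nat → Ty} {Ts Ts' : List Ty} {Rs Rs' : List (Set Tm)},
      (∀ i < p, ScopedTy Ts.length (σ i)) →
      (∀ i < p, Ts'[i]? = some (subTyList Ts (σ i))) →
      (∀ i < p, RED (σ i) Ts Rs = Rs'.getD i ∅) →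
      RED (subTy σ S) Ts Rs = RED S Ts' Rs' := by
  induction hS with
  | var hn => intro σ Ts Ts' Rs Rs' _ _ hR; exact hR _ hn
  | arrow ha hb iha ihb =>
    intro σ Ts Ts' Rs Rs' hσ hT hR
    have h := subTyList_subTy (.arrow ha hb) hT
    simp only [subTy] at h
    simp only [RED, subTy, iha hσ hT hR, ihb hσ hT hR, subTyList_subTy hb hT, h]
  | @all p a ha ih =>
    intro σ Ts Ts' Rs Rs' hσ hT hR
    have h := subTyList_subTy (.all ha) hT
    simp only [subTy] at h
    have hσ' : ∀ U : Ty, ∀ i < p + 1, ScopedTy (U :: Ts).length (liftTySub σ i) := by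
      rintro U (_ | i) hi
      · exact .var (Nat.succ_pos _)
      · exact (hσ i (by omega)).renTy fun j hj => Nat.succ_lt_succ hj
    have hT' : ∀ U : Ty, ∀ i < p + 1,
        (U :: Ts')[i]? = some (subTyList (U :: Ts) (liftTySub σ i)) := by
      rintro U (_ | i) hi
      · rfl
      · have hi' : i < p := by omega
        rw [liftTySub, subTyList_renTy (hσ i hi') (exists_getElem?_cons_succ U Ts),
          List.getElem?_cons_succ, hT i hi']
    have hR' : ∀ (U : Ty) (Rc : Set Tm), ∀ i < p + 1,
        RED (liftTySub σ i) (U :: Ts) (Rc :: Rs) = (Rc :: Rs').getD i ∅ := by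
      rintro U Rc (_ | i) hi
      · rfl
      · have hi' : i < p := by omega
        rw [liftTySub, List.getD_cons_succ, ← hR i hi']
        exact RED_renTy (hσ i hi') (exists_getElem?_cons_succ U Ts)
          fun j _ => List.getD_cons_succ
    have hlift := fun U => subTyList_subTy ha (hT' U)
    have hRED := fun U Rc => ih (hσ' U) (hT' U) (hR' U Rc)
    simp only [RED, subTy, h, hlift, hRED]

/-- **Substitution lemma for parametric reducibility candidates** (Lemma 1 of
Section 2.3).  The bound type variable `c` is represented by the de Bruijn
type variable `0`, and the sequence `ᾱ` by the variables `1,…,p` in `S`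
(resp. `0,…,p-1` in `T`): for every type `S` with free type variables among
`ᾱ, c`, every type `T` with free type variables among `ᾱ`, every sequence of
types `Ts` interpreting `ᾱ`, and every sequence of reducibility candidates
`Rs` with `Rs i ∈ RC(Ts i)`, we have
`RED_{S[c:=T]}(ᾱ ↦ R̄) = RED_S(ᾱ, c ↦ R̄, RED_T(ᾱ ↦ R̄))`. -/
theorem RED_subst
    (S T : Ty) (Ts : List Ty) (Rs : List (Set Tm))
    (hS : ScopedTy (Ts.length + 1) S)
    (hT : ScopedTy Ts.length T)
    (hlen : Ts.length = Rs.length)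
    (hcand : ∀ i < Ts.length, IsCand (Ts.getD i (.var 0)) (Rs.getD i ∅)) :
    RED (subTy0 T S) Ts Rs = RED S (subTyList Ts T :: Ts) (RED T Ts Rs :: Rs) := by
  refine RED_subTy hS ?_ ?_ ?_
  · rintro (_ | i) hi
    · exact hT
    · exact .var (by omega)
  · rintro (_ | i) hi
    · rfl
    · have hi' : i < Ts.length := by omega
      simp [subTyList, subTy, hi']
  · rintro (_ | i) _ <;> rfl

end LambdaFv
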